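/- arXiv:2101.07846 — 6 statements merged into one kernel-verified Lean document; each statement's English description precedes it below -/
import Mathlib

section
/- Suppose K ≥ 2. Then the powers of A stabilize after K−1 steps: for every natural number j with j ≥ K−1, one has Aʲ = A^{K−1}. -/
/-- The `s×s` matrix `𝔼` whose last column is all ones and all other entries
are zero. -/
def EMat (s : ℕ) : Matrix (Fin s) (Fin s) ℝ :=
  fun _ j => if (j : ℕ) = s - 1 then 1 else 0

/-- The `s(K+1) × s(K+1)` block matrix `A`, with `(K+1)×(K+1)` blocks of size
`s×s` indexed by `0,…,K`, whose only nonzero blocks are: block `(0,0) = 𝔼`;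
block `(k, k+1) = 𝔼` for `1 ≤ k ≤ K−1`; and block `(K,K) = 𝔼`. -/
def AMat (s K : ℕ) :
    Matrix (Fin (K + 1) × Fin s) (Fin (K + 1) × Fin s) ℝ :=
  fun p q =>
    if ((p.1 : ℕ) = 0 ∧ (q.1 : ℕ) = 0) ∨
        (1 ≤ (p.1 : ℕ) ∧ (p.1 : ℕ) ≤ K - 1 ∧ (q.1 : ℕ) = (p.1 : ℕ) + 1) ∨
        ((p.1 : ℕ) = K ∧ (q.1 : ℕ) = K)
    then EMat s p.2 q.2 else 0

/-- The map on block indices and inner indices that sends each row of `AMat s K` to the position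
of its unique nonzero entry. -/
def rowTarget (s K : ℕ) (hs : 1 ≤ s) (p : Fin (K + 1) × Fin s) : Fin (K + 1) × Fin s :=
  (⟨if (p.1 : ℕ) = 0 then 0 else min ((p.1 : ℕ) + 1) K, by split_ifs <;> omega⟩,
    ⟨s - 1, by omega⟩)

theorem AMat_eq_submatrix_rowTarget (s K : ℕ) (hs : 1 ≤ s) (hK : 1 ≤ K) :
    AMat s K = (1 : Matrix _ _ ℝ).submatrix (rowTarget s K hs) id := by
  ext ⟨⟨a, ha⟩, b⟩ ⟨⟨c, hc⟩, d⟩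
  simp only [AMat, EMat, rowTarget, Matrix.submatrix_apply, Matrix.one_apply, id, Prod.mk.injEq,
    Fin.ext_iff, ← ite_and]
  congr 1
  rw [eq_iff_iff]
  split_ifs <;> omega

/-- Powers of the matrix of a self-map are the matrices of its iterates. -/
theorem Matrix.one_submatrix_pow {n R : Type*} [Fintype n] [DecidableEq n] [Semiring R]
    (g : n → n) (m : ℕ) :
    ((1 : Matrix n n R).submatrix g id) ^ m = (1 : Matrix n n R).submatrix g^[m] id := by
  induction m with
  | zero => simp
  | succ m ih =>
    rw [pow_succ, ih]
    ext p q
    rw [Matrix.mul_apply, Finset.sum_eq_single (g^[m] p)]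
    · rw [Matrix.submatrix_apply, Matrix.submatrix_apply, Matrix.submatrix_apply, id, id,
        Matrix.one_apply_eq, one_mul, Function.iterate_succ_apply']
    · intro b _ hb
      rw [Matrix.submatrix_apply, id, Matrix.one_apply_ne hb.symm, zero_mul]
    · simp

theorem rowTarget_iterate_fst (s K : ℕ) (hs : 1 ≤ s) (p : Fin (K + 1) × Fin s) (n : ℕ) :
    (((rowTarget s K hs)^[n] p).1 : ℕ) = if (p.1 : ℕ) = 0 then 0 else min ((p.1 : ℕ) + n) K := by
  induction n with
  | zero =>
    have := p.1.isLt
    simp only [Function.iterate_zero, id]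
    split_ifs <;> omega
  | succ n ih =>
    rw [Function.iterate_succ_apply', rowTarget]
    dsimp only
    rw [ih]
    split_ifs <;> omega

theorem rowTarget_iterate_snd (s K : ℕ) (hs : 1 ≤ s) (p : Fin (K + 1) × Fin s) {n : ℕ}
    (hn : 1 ≤ n) : (((rowTarget s K hs)^[n] p).2 : ℕ) = s - 1 := by
  obtain ⟨m, rfl⟩ := Nat.exists_eq_add_of_le' hn
  rw [Function.iterate_succ_apply', rowTarget]

/-- For `K ≥ 2`, the powers of `A` stabilize after `K − 1` steps:
`Aʲ = A^{K−1}` for every `j ≥ K − 1`. -/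
theorem stmt_4 (s K : ℕ) (hs : 1 ≤ s) (hK : 2 ≤ K) (j : ℕ) (hj : K - 1 ≤ j) :
    (AMat s K) ^ j = (AMat s K) ^ (K - 1) := by
  rw [AMat_eq_submatrix_rowTarget s K hs (by omega), Matrix.one_submatrix_pow,
    Matrix.one_submatrix_pow]
  congr 1
  funext p
  refine Prod.ext (Fin.ext ?_) (Fin.ext ?_)
  · rw [rowTarget_iterate_fst, rowTarget_iterate_fst]
    split_ifs <;> omega
  · rw [rowTarget_iterate_snd s K hs p (by omega), rowTarget_iterate_snd s K hs p (by omega)]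
end

section
/- For every polynomial p with real coefficients of degree at most 5, the three-point Hermite quadrature rule given by the final stage of the sixth-order two-derivative Runge–Kutta collocation method is exact: ∫₀¹ p(t) dt = (7/30)·p(0) + (16/30)·p(1/2) + (7/30)·p(1) + (5/300)·p'(0) − (5/300)·p'(1). -/
/-- The three-point Hermite quadrature rule of the final stage of the
sixth-order two-derivative Runge–Kutta collocation method is exact for
polynomials of degree at most 5. -/
theorem stmt_10 (p : Polynomial ℝ) (hp : p.degree ≤ 5) :
    ∫ t in (0:ℝ)..1, p.eval t
      = (7/30) * p.eval 0 + (16/30) * p.eval (1/2) + (7/30) * p.eval 1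
        + (5/300) * p.derivative.eval 0 - (5/300) * p.derivative.eval 1 := by
  have hn : p.natDegree < 6 :=
    Nat.lt_succ_of_le (Polynomial.natDegree_le_of_degree_le hp)
  have hint : ∫ t in (0:ℝ)..1, p.eval t
      = ∑ i ∈ Finset.range 6, p.coeff i * (1 / ((i : ℝ) + 1)) := by
    simp_rw [Polynomial.eval_eq_sum_range' hn]
    rw [intervalIntegral.integral_finsetSum fun i _ =>
      Continuous.intervalIntegrable (by fun_prop) _ _]
    simp [integral_pow]
  rw [hint, p.as_sum_range' 6 hn]
  simp [Finset.sum_range_succ, Polynomial.coeff_monomial]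
  ring
end

section
/- For every polynomial p with real coefficients of degree at most 5, the Hermite–Birkhoff quadrature rule given by the middle stage of the sixth-order two-derivative Runge–Kutta collocation method is exact: ∫₀^{1/2} p(t) dt = (101/480)·p(0) + (8/30)·p(1/2) + (55/2400)·p(1) + (65/4800)·p'(0) − (25/600)·p'(1/2) − (25/8000)·p'(1). -/
/-- The Hermite–Birkhoff quadrature rule of the middle stage of the
sixth-order two-derivative Runge–Kutta collocation method is exact for
polynomials of degree at most 5. -/
theorem stmt_11 (p : Polynomial ℝ) (hp : p.degree ≤ 5) :
    ∫ t in (0:ℝ)..(1/2), p.eval t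
      = (101/480) * p.eval 0 + (8/30) * p.eval (1/2) + (55/2400) * p.eval 1
        + (65/4800) * p.derivative.eval 0 - (25/600) * p.derivative.eval (1/2)
        - (25/8000) * p.derivative.eval 1 := by
  have hdeg : p.natDegree < 6 :=
    Nat.lt_succ_of_le (Polynomial.natDegree_le_of_degree_le hp)
  have heval (t : ℝ) : p.eval t = ∑ i ∈ Finset.range 6, p.coeff i * t ^ i :=
    Polynomial.eval_eq_sum_range' hdeg t
  have hderiv (t : ℝ) :
      p.derivative.eval t = ∑ i ∈ Finset.range 6, p.coeff i * i * t ^ (i - 1) := by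
    rw [Polynomial.derivative_eval]
    exact p.sum_over_range' (by simp) 6 hdeg
  have hint : ∫ t in (0:ℝ)..(1/2), p.eval t
      = ∑ i ∈ Finset.range 6, p.coeff i * ((1/2) ^ (i + 1) / (i + 1)) := by
    simp_rw [heval]
    rw [intervalIntegral.integral_finsetSum
      fun i _ => Continuous.intervalIntegrable (by fun_prop) _ _]
    simp
  rw [hint]
  simp only [heval, hderiv, Finset.sum_range_succ, Finset.sum_range_zero]
  norm_num
  ring
end

section
/- For every polynomial p with real coefficients of degree at most 7, the four-point Hermite quadrature rule given by the final stage of the eighth-order two-derivative Runge–Kutta collocation method is exact: ∫₀¹ p(t) dt = (31/224)·p(0) + (81/224)·p(1/3) + (81/224)·p(2/3) + (31/224)·p(1) + (19/3360)·p'(0) − (9/1120)·p'(1/3) + (9/1120)·p'(2/3) − (19/3360)·p'(1). -/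
/-- The integral over `[0, 1]` of a real polynomial of degree less than `n`, in terms of its
coefficients. -/
theorem Polynomial.integral_eval_zero_one_eq_sum_range (p : Polynomial ℝ) {n : ℕ}
    (hn : p.natDegree < n) :
    ∫ t in (0:ℝ)..1, p.eval t = ∑ i ∈ Finset.range n, p.coeff i / (i + 1) := by
  simp_rw [Polynomial.eval_eq_sum_range' hn]
  rw [intervalIntegral.integral_finsetSum
    fun i _ => Continuous.intervalIntegrable (by fun_prop) _ _]
  simp [integral_pow, div_eq_mul_inv]

/-- The four-point Hermite quadrature rule of the final stage of the
eighth-order two-derivative Runge–Kutta collocation method is exact for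
polynomials of degree at most 7. -/
theorem stmt_12 (p : Polynomial ℝ) (hp : p.degree ≤ 7) :
    ∫ t in (0:ℝ)..1, p.eval t
      = (31/224) * p.eval 0 + (81/224) * p.eval (1/3) + (81/224) * p.eval (2/3)
        + (31/224) * p.eval 1
        + (19/3360) * p.derivative.eval 0 - (9/1120) * p.derivative.eval (1/3)
        + (9/1120) * p.derivative.eval (2/3) - (19/3360) * p.derivative.eval 1 := by
  have hn : p.natDegree < 8 := Nat.lt_succ_of_le (Polynomial.natDegree_le_of_degree_le hp)
  have hn' : p.derivative.natDegree < 7 := by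
    have := p.natDegree_derivative_le
    omega
  rw [p.integral_eval_zero_one_eq_sum_range hn]
  simp only [Polynomial.eval_eq_sum_range' hn, Polynomial.eval_eq_sum_range' hn',
    Polynomial.coeff_derivative, Finset.sum_range_succ, Finset.sum_range_zero]
  norm_num
  ring
end

section
/- For every polynomial p with real coefficients of degree at most 7, the Hermite–Birkhoff quadrature rule given by the second stage of the eighth-order two-derivative Runge–Kutta collocation method is exact: ∫₀^{1/3} p(t) dt = (6893/54432)·p(0) + (313/2016)·p(1/3) + (89/2016)·p(2/3) + (397/54432)·p(1) + (1283/272160)·p'(0) − (851/30240)·p'(1/3) − (269/30240)·p'(2/3) − (163/272160)·p'(1). -/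
/-- The Hermite–Birkhoff quadrature rule of the second stage of the
eighth-order two-derivative Runge–Kutta collocation method is exact for
polynomials of degree at most 7. -/
theorem stmt_13 (p : Polynomial ℝ) (hp : p.degree ≤ 7) :
    ∫ t in (0:ℝ)..(1/3), p.eval t
      = (6893/54432) * p.eval 0 + (313/2016) * p.eval (1/3)
        + (89/2016) * p.eval (2/3) + (397/54432) * p.eval 1
        + (1283/272160) * p.derivative.eval 0 - (851/30240) * p.derivative.eval (1/3)
        - (269/30240) * p.derivative.eval (2/3) - (163/272160) * p.derivative.eval 1 := by
  have hdeg : p.natDegree < 8 :=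
    Nat.lt_succ_of_le (Polynomial.natDegree_le_of_degree_le hp)
  have hderiv : p.derivative.natDegree < 8 :=
    (Polynomial.natDegree_derivative_le p).trans_lt (by omega)
  have hcoeff : p.coeff 8 = 0 := Polynomial.coeff_eq_zero_of_natDegree_lt hdeg
  have hint : ∫ t in (0:ℝ)..(1/3), p.eval t
      = ∑ i ∈ Finset.range 8, p.coeff i * ((1/3 : ℝ) ^ (i + 1) / (i + 1)) := by
    simp_rw [Polynomial.eval_eq_sum_range' hdeg]
    rw [intervalIntegral.integral_finsetSum fun i _ =>
      (by fun_prop : Continuous fun t : ℝ => p.coeff i * t ^ i).intervalIntegrable _ _]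
    simp [integral_pow]
  rw [hint]
  simp only [Polynomial.eval_eq_sum_range' hdeg, Polynomial.eval_eq_sum_range' hderiv,
    Finset.sum_range_succ, Finset.sum_range_zero, Polynomial.coeff_derivative]
  norm_num [hcoeff]
  ring
end

section
/- For every polynomial p with real coefficients of degree at most 7, the Hermite–Birkhoff quadrature rule given by the third stage of the eighth-order two-derivative Runge–Kutta collocation method is exact: ∫₀^{2/3} p(t) dt = (223/1701)·p(0) + (20/63)·p(1/3) + (13/63)·p(2/3) + (20/1701)·p(1) + (43/8505)·p'(0) − (16/945)·p'(1/3) − (19/945)·p'(2/3) − (8/8505)·p'(1). -/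
/-- The Hermite–Birkhoff quadrature rule of the third stage of the
eighth-order two-derivative Runge–Kutta collocation method is exact for
polynomials of degree at most 7. -/
theorem stmt_14 (p : Polynomial ℝ) (hp : p.degree ≤ 7) :
    ∫ t in (0:ℝ)..(2/3), p.eval t
      = (223/1701) * p.eval 0 + (20/63) * p.eval (1/3)
        + (13/63) * p.eval (2/3) + (20/1701) * p.eval 1
        + (43/8505) * p.derivative.eval 0 - (16/945) * p.derivative.eval (1/3)
        - (19/945) * p.derivative.eval (2/3) - (8/8505) * p.derivative.eval 1 := by
  have hlt : p.natDegree < 8 :=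
    Nat.lt_succ_of_le (Polynomial.natDegree_le_of_degree_le hp)
  have heval (t : ℝ) : p.eval t = ∑ k ∈ Finset.range 8, p.coeff k * t ^ k :=
    Polynomial.eval_eq_sum_range' hlt t
  have hderiv (t : ℝ) : p.derivative.eval t =
      ∑ k ∈ Finset.range 8, p.coeff k * (k * t ^ (k - 1)) := by
    conv_lhs => rw [p.as_sum_range' 8 hlt]
    simp [Polynomial.eval_finsetSum,
      Polynomial.derivative_monomial, mul_assoc]
  have hint : ∫ t in (0:ℝ)..(2/3), p.eval t =
      ∑ k ∈ Finset.range 8, p.coeff k * ((2/3) ^ (k + 1) / (k + 1)) := by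
    simp_rw [heval]
    rw [intervalIntegral.integral_finsetSum fun k _ =>
      (by fun_prop : Continuous fun t : ℝ => p.coeff k * t ^ k).intervalIntegrable _ _]
    simp [integral_pow]
  rw [hint]
  simp only [heval, hderiv, Finset.sum_range_succ, Finset.sum_range_zero]
  norm_num
  ring
end
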